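/- Let {X_n} be a stationary and ergodic time series with values in a finite or countably infinite set 𝒳 with finite entropy rate H, and let 0 < ε₂ < ε₁. Then for every k ≥ 1, P(ζ_k ≥ 2^{l_k(H+ε₁)} and X̃_{−l_k+1}^0 ∈ B_k) ≤ (k+1) 2^{−l_k(ε₁−ε₂)}, where B_k = { x_{−l_k+1}^0 ∈ 𝒳^{l_k} : p_{l_k−1}(x_{−l_k+1}^0) > 2^{−l_k(H+ε₂)} }. -/

import Mathlib

open MeasureTheory Filter Set
open scoped ENNReal Topology

noncomputable section

namespace MWPrediction

/-- The canonical two-sided path space for a process with values in `𝒳`. -/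
abbrev Path (𝒳 : Type*) := ℤ → 𝒳

variable {𝒳 : Type*}

/-- The left shift `(T ω) i = ω (i+1)` on two-sided sequences. -/
def shift (ω : Path 𝒳) : Path 𝒳 := fun i => ω (i + 1)

/-- The one-sided past `X⁰_{-∞}`, recorded as `past ω i = X_{-i}`. -/
def past (ω : Path 𝒳) : ℕ → 𝒳 := fun i => ω (-(i : ℤ))

/-- The string `s` of length `m` (read right-to-left: `s j` is the symbol at
position `t - j`) occurs in `ω` ending at time `t`. -/
def OccursAt (ω : Path 𝒳) (m : ℕ) (s : ℕ → 𝒳) (t : ℤ) : Prop :=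
  ∀ j < m, ω (t - (j : ℤ)) = s j

/-- The auxiliary stopping times `ζ_n`:  `ζ_0 = 0` and `ζ_n` is obtained from
`ζ_{n-1}` by waiting for the recurrence of the block of length `l n` ending
at `ζ_{n-1}`. -/
def zeta (l : ℕ → ℕ) (ω : Path 𝒳) : ℕ → ℤ
  | 0 => 0
  | n + 1 =>
    zeta l ω n +
      ((sInf {t : ℕ | 0 < t ∧ ∀ s < l (n + 1),
          ω (zeta l ω n - (s : ℤ) + (t : ℤ)) = ω (zeta l ω n - (s : ℤ))} : ℕ) : ℤ)

/-- `J n = min { j ≥ 1 : l (j+1) > n }`. -/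
def Jfun (l : ℕ → ℕ) (n : ℕ) : ℕ := sInf {j : ℕ | 1 ≤ j ∧ n < l (j + 1)}

/-- The auxiliary process `X̃`: `tildePast l ω i = X̃_{-i} = X_{ζ_{J(i)} - i}`. -/
def tildePast (l : ℕ → ℕ) (ω : Path 𝒳) : ℕ → 𝒳 :=
  fun i => ω (zeta l ω (Jfun l i) - (i : ℤ))

variable [MeasurableSpace 𝒳]

/-- `pstr μ m s = P(X_{-m+1}^0 = s)`, the probability that the string `s` of
length `m` (read right-to-left) occupies positions `-m+1, …, 0`.
(So `pstr μ (k+1)` is `p_k` of the paper.) -/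
def pstr (μ : Measure (Path 𝒳)) (m : ℕ) (s : ℕ → 𝒳) : ℝ :=
  (μ {ω | ∀ j < m, ω (-(j : ℤ)) = s j}).toReal

/-- `pcond μ m y s = P(X_1 = y | X_{-m+1}^0 = s)`, conditioning on `m` symbols.
(So `pcond μ m` is `p_{m-1}(·|·)` of the paper.) -/
def pcond (μ : Measure (Path 𝒳)) (m : ℕ) (y : 𝒳) (s : ℕ → 𝒳) : ℝ :=
  (μ {ω | ω 1 = y ∧ ∀ j < m, ω (-(j : ℤ)) = s j}).toReal / pstr μ m s

/-- Append `y` as the new rightmost symbol of the string `s`. -/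
def withLast (y : 𝒳) (s : ℕ → 𝒳) : ℕ → 𝒳 := fun j => if j = 0 then y else s (j - 1)

/-- The string which agrees with `b` on its rightmost `k` symbols and continues
to the left with `z`:  this is the string `(z, b_{-k+1}^0)` of the paper. -/
def prependOld (b : ℕ → 𝒳) (k : ℕ) (z : ℕ → 𝒳) : ℕ → 𝒳 :=
  fun j => if j < k then b j else z (j - k)

/-- `K` is a memory bound for the past `b`: for all `i ≥ 1`, `y` and `z ∈ 𝒳^i`,
if `p_{K+i}(z, b_{-K+1}^0, y) > 0` then
`p_{K-1}(y | b_{-K+1}^0) = p_{K+i-1}(y | z, b_{-K+1}^0)`. -/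
def IsMemoryBound (μ : Measure (Path 𝒳)) (b : ℕ → 𝒳) (K : ℕ) : Prop :=
  ∀ i : ℕ, 1 ≤ i → ∀ y : 𝒳, ∀ z : ℕ → 𝒳,
    0 < pstr μ (K + i + 1) (withLast y (prependOld b K z)) →
    pcond μ K y b = pcond μ (K + i) y (prependOld b K z)

/-- The (random) memory length `K(b)` of a one-sided path `b`: the smallest
memory bound, and `∞` if there is none. -/
def memLen (μ : Measure (Path 𝒳)) (b : ℕ → 𝒳) : ℕ∞ :=
  sInf {n : ℕ∞ | ∃ K : ℕ, n = (K : ℕ∞) ∧ IsMemoryBound μ b K}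

/-- `Δ_k(b_{-k+1}^0)`. -/
def Delta (μ : Measure (Path 𝒳)) (k : ℕ) (b : ℕ → 𝒳) : ℝ :=
  sSup {d : ℝ | ∃ i : ℕ, 1 ≤ i ∧ ∃ z : ℕ → 𝒳, ∃ x : 𝒳,
    0 < pstr μ (k + i + 1) (withLast x (prependOld b k z)) ∧
    d = |pcond μ k x b - pcond μ (k + i) x (prependOld b k z)|}

/-- `⌈n/2⌉`. -/
def half (n : ℕ) : ℕ := (n + 1) / 2

open Classical in
/-- The number of times `t ∈ [a, b]` at which the string `s` of length `m`
occurs in `ω` ending at `t`. -/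
def cnt (ω : Path 𝒳) (m : ℕ) (s : ℕ → 𝒳) (a b : ℤ) : ℕ :=
  ((Finset.Icc a b).filter fun t => OccursAt ω m s t).card

/-- Membership in `ℒ_{n,m}^{(1)}`: the string `s` of length `m+1` occurs in
`X_0^{⌈n/2⌉ - 1}`. -/
def inL1 (ω : Path 𝒳) (n m : ℕ) (s : ℕ → 𝒳) : Prop :=
  ∃ t : ℤ, (m : ℤ) ≤ t ∧ t ≤ (half n : ℤ) - 1 ∧ OccursAt ω (m + 1) s t

/-- Membership in `ℒ_{n,m}^{(2)}`: the string `s` of length `m+1` occurs more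
than `n^{1-γ}` times in `X_{⌈n/2⌉}^n`. -/
def inL2 (γ : ℝ) (ω : Path 𝒳) (n m : ℕ) (s : ℕ → 𝒳) : Prop :=
  (n : ℝ) ^ (1 - γ) < (cnt ω (m + 1) s ((half n : ℤ) + (m : ℤ)) (n : ℤ) : ℝ)

/-- Membership in `ℒ_m^n = ℒ_{n,m}^{(1)} ∩ ℒ_{n,m}^{(2)}`. -/
def inL (γ : ℝ) (ω : Path 𝒳) (n m : ℕ) (s : ℕ → 𝒳) : Prop :=
  inL1 ω n m s ∧ inL2 γ ω n m s

/-- The empirical conditional relative frequency of `x` following the string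
`s` of length `m`, computed in the second half `X_{⌈n/2⌉}^n` of the data. -/
def empCond (ω : Path 𝒳) (n m : ℕ) (x : 𝒳) (s : ℕ → 𝒳) : ℝ :=
  (cnt ω (m + 1) (withLast x s) ((half n : ℤ) + (m : ℤ)) (n : ℤ) : ℝ) /
    (cnt ω m s ((half n : ℤ) + (m : ℤ) - 1) ((n : ℤ) - 1) : ℝ)

/-- The empirical statistic `Δ̂_k^n(X̃_{-k+1}^0)`. -/
def hatDelta (γ : ℝ) (l : ℕ → ℕ) (ω : Path 𝒳) (n k : ℕ) : ℝ :=
  (if zeta l ω (Jfun l k) ≤ (half n : ℤ) - 1 then (1 : ℝ) else 0) *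
    sSup {d : ℝ | ∃ i : ℕ, 1 ≤ i ∧ i ≤ n ∧ ∃ z : ℕ → 𝒳, ∃ x : 𝒳,
      inL γ ω n (k + i) (withLast x (prependOld (tildePast l ω) k z)) ∧
      d = |empCond ω n k x (tildePast l ω) -
            empCond ω n (k + i) x (prependOld (tildePast l ω) k z)|}

/-- The order estimate `χ_n`: the smallest `0 ≤ k < n` with `Δ̂_k^n ≤ n^{-β}`
(and `χ_0 = 0`). -/
def chi (β γ : ℝ) (l : ℕ → ℕ) (ω : Path 𝒳) (n : ℕ) : ℕ :=
  sInf {k : ℕ | k < n ∧ hatDelta γ l ω n k ≤ (n : ℝ) ^ (-β)}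

/-- The index `j` with `ζ_j ≤ v < ζ_{j+1}`. -/
def jIndex (l : ℕ → ℕ) (ω : Path 𝒳) (v : ℤ) : ℕ := sInf {j : ℕ | v < zeta l ω (j + 1)}

/-- The stopping times `λ_n`:  `λ_0 = 0` and, if `ζ_j ≤ λ_{n-1} < ζ_{j+1}`,
`λ_n = min { t > λ_{n-1} : X_{t - χ_t + 1}^t = X_{ζ_j - χ_t + 1}^{ζ_j} }`. -/
def lambda (β γ : ℝ) (l : ℕ → ℕ) (ω : Path 𝒳) : ℕ → ℤ
  | 0 => 0
  | n + 1 =>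
    lambda β γ l ω n + 1 +
      ((sInf {s : ℕ |
          ∀ r < chi β γ l ω (lambda β γ l ω n + 1 + (s : ℤ)).toNat,
            ω (lambda β γ l ω n + 1 + (s : ℤ) - (r : ℤ)) =
              ω (zeta l ω (jIndex l ω (lambda β γ l ω n)) - (r : ℤ))} : ℕ) : ℤ)

/-- `κ_n = χ_{λ_n}`. -/
def kappa (β γ : ℝ) (l : ℕ → ℕ) (ω : Path 𝒳) (n : ℕ) : ℕ :=
  chi β γ l ω (lambda β γ l ω n).toNat

/-- The estimator `f_n = (1/n) ∑_{j=0}^{n-1} f(X_{λ_j + 1})`. -/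
def fEst (β γ : ℝ) (l : ℕ → ℕ) (f : 𝒳 → ℝ) (ω : Path 𝒳) (n : ℕ) : ℝ :=
  (1 / (n : ℝ)) * ∑ j ∈ Finset.range n, f (ω (lambda β γ l ω j + 1))

open Classical in
/-- The metric `d*` on one-sided sequences. -/
def dstar (x y : ℕ → 𝒳) : ℝ :=
  ∑' i : ℕ, (2 : ℝ)⁻¹ ^ (i + 1) * (if x i ≠ y i then 1 else 0)

/-- `F` restricted to `C` is continuous with respect to the metric `d*`. -/
def ContinuousOnDstar (F : (ℕ → 𝒳) → ℝ) (C : Set (ℕ → 𝒳)) : Prop :=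
  ∀ x ∈ C, ∀ ε > 0, ∃ δ > 0, ∀ y ∈ C, dstar x y < δ → |F y - F x| < ε

/-- The σ-algebra generated by the one-sided past `X^0_{-∞}`. -/
def pastSigma (𝒳 : Type*) [MeasurableSpace 𝒳] : MeasurableSpace (Path 𝒳) :=
  MeasurableSpace.comap past inferInstance

/-- `F` is a version of the conditional expectation `E(f(X_1) | X^0_{-∞})`. -/
def IsPredictor (μ : Measure (Path 𝒳)) (f : 𝒳 → ℝ) (F : (ℕ → 𝒳) → ℝ) : Prop :=
  (fun ω => F (past ω)) =ᵐ[μ] μ[fun ω => f (ω 1)|pastSigma 𝒳]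

/-- `F` (a version of `E(f(X_1)|X^0_{-∞})`) is almost surely continuous:
it is continuous w.r.t. `d*` on a set of paths of probability one. -/
def ASContinuousCondExp (μ : Measure (Path 𝒳)) (F : (ℕ → 𝒳) → ℝ) : Prop :=
  ∃ C : Set (ℕ → 𝒳), μ (past ⁻¹' C) = 1 ∧ ContinuousOnDstar F C

/-- The observation `(λ_j, X_0^{λ_j})`, encoding the data segment available at
time `λ_j` (values before time `0` are clamped to `X_0`). -/
def segObs (β γ : ℝ) (l : ℕ → ℕ) (j : ℕ) (ω : Path 𝒳) : ℤ × (ℕ → 𝒳) :=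
  (lambda β γ l ω j, fun i => ω (max (lambda β γ l ω j - (i : ℤ)) 0))

/-- The σ-algebra generated by `(λ_j, X_0^{λ_j})`. -/
def segSigma (β γ : ℝ) (l : ℕ → ℕ) (j : ℕ) : MeasurableSpace (Path 𝒳) :=
  MeasurableSpace.comap (segObs β γ l j) inferInstance

/-- The observation `(λ_j, X_{-∞}^{λ_j})`: the full past at time `λ_j`. -/
def fullPastObs (β γ : ℝ) (l : ℕ → ℕ) (j : ℕ) (ω : Path 𝒳) : ℤ × (ℕ → 𝒳) :=
  (lambda β γ l ω j, fun i => ω (lambda β γ l ω j - (i : ℤ)))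

/-- The σ-algebra generated by `(λ_j, X_{-∞}^{λ_j})`. -/
def fullPastSigma (β γ : ℝ) (l : ℕ → ℕ) (j : ℕ) : MeasurableSpace (Path 𝒳) :=
  MeasurableSpace.comap (fullPastObs β γ l j) inferInstance

/-- The `n`-th term `-(1/(n+1)) ∑ p log₂ p` of the entropy rate. -/
def entropyTerm (μ : Measure (Path 𝒳)) (n : ℕ) : ℝ :=
  -(1 / ((n : ℝ) + 1)) *
    ∑' s : Fin (n + 1) → 𝒳,
      pstr μ (n + 1) (fun j => if h : j < n + 1 then s ⟨j, h⟩ else s ⟨0, Nat.succ_pos n⟩) *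
        Real.logb 2
          (pstr μ (n + 1) (fun j => if h : j < n + 1 then s ⟨j, h⟩ else s ⟨0, Nat.succ_pos n⟩))

/-- The process has entropy rate `H`. -/
def HasEntropyRate (μ : Measure (Path 𝒳)) (H : ℝ) : Prop :=
  Tendsto (entropyTerm μ) atTop (nhds H)

/-- The backward stopping times `ζ̂_i^k`. -/
def hatZeta (l : ℕ → ℕ) (k : ℕ) (ω : Path 𝒳) : ℕ → ℤ
  | 0 => 0
  | i + 1 =>
    hatZeta l k ω i -
      ((sInf {t : ℕ | 0 < t ∧ ∀ s < l (k - i),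
          ω (hatZeta l k ω i - (s : ℤ) - (t : ℤ)) = ω (hatZeta l k ω i - (s : ℤ))} : ℕ) : ℤ)


/-- The next time after `a` at which the block of length `m` ending at `a` recurs
(`a` itself if it never does). -/
def nextOcc {α : Type*} (m : ℕ) (ω : Path α) (a : ℤ) : ℤ :=
  a + ((sInf {t : ℕ | 0 < t ∧ ∀ s < m, ω (a - (s : ℤ) + (t : ℤ)) = ω (a - (s : ℤ))} : ℕ) : ℤ)

/-- The times `ζ_n`, started from time `a` instead of time `0`. -/
def zetaFrom {α : Type*} (l : ℕ → ℕ) (ω : Path α) (a : ℤ) : ℕ → ℤ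
  | 0 => a
  | n + 1 => nextOcc (l (n + 1)) ω (zetaFrom l ω a n)

/-- Every finite block of `ω` recurs in the future. -/
def Recurrent {α : Type*} (ω : Path α) : Prop :=
  ∀ (a : ℤ) (m : ℕ), ∃ t : ℕ, 0 < t ∧ ∀ s < m, ω (a - (s : ℤ) + (t : ℤ)) = ω (a - (s : ℤ))

section Combinatorics

variable {α : Type*} {ω : Path α} {l : ℕ → ℕ}

lemma nextOcc_block (m : ℕ) (ω : Path α) (a : ℤ) {j : ℕ} (hj : j < m) :
    ω (nextOcc m ω a - (j : ℤ)) = ω (a - (j : ℤ)) := by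
  unfold nextOcc
  set S := {t : ℕ | 0 < t ∧ ∀ s < m, ω (a - (s : ℤ) + (t : ℤ)) = ω (a - (s : ℤ))} with hS
  rcases S.eq_empty_or_nonempty with h | h
  · simp [h]
  · have := (Nat.sInf_mem h).2 j hj
    rwa [sub_add_eq_add_sub] at this

lemma nextOcc_le {m : ℕ} {a b : ℤ} (hab : a < b)
    (h : ∀ j < m, ω (b - (j : ℤ)) = ω (a - (j : ℤ))) : nextOcc m ω a ≤ b := by
  unfold nextOcc
  have hmem : (b - a).toNat ∈
      {t : ℕ | 0 < t ∧ ∀ s < m, ω (a - (s : ℤ) + (t : ℤ)) = ω (a - (s : ℤ))} := by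
    refine ⟨by omega, fun s hs => ?_⟩
    rw [← h s hs]
    congr 1
    omega
  have := Nat.sInf_le hmem
  omega

lemma Recurrent.lt_nextOcc (h : Recurrent ω) (m : ℕ) (a : ℤ) : a < nextOcc m ω a := by
  unfold nextOcc
  have : 0 < sInf {t : ℕ | 0 < t ∧ ∀ s < m, ω (a - (s : ℤ) + (t : ℤ)) = ω (a - (s : ℤ))} :=
    (Nat.sInf_mem (h a m)).1
  omega

lemma Recurrent.nextOcc_injective (h : Recurrent ω) (m : ℕ) :
    Function.Injective (nextOcc m ω) := by
  have key : ∀ a b : ℤ, a < b → nextOcc m ω a ≠ nextOcc m ω b := fun a b hab heq => by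
    have hle : nextOcc m ω a ≤ b := nextOcc_le hab fun j hj => by
      rw [← nextOcc_block m ω b hj, ← heq, nextOcc_block m ω a hj]
    have := h.lt_nextOcc m b
    omega
  intro a b hab
  rcases lt_trichotomy a b with hlt | heq | hlt
  · exact absurd hab (key a b hlt)
  · exact heq
  · exact absurd hab.symm (key b a hlt)

lemma Recurrent.zetaFrom_injective (h : Recurrent ω) (l : ℕ → ℕ) (n : ℕ) :
    Function.Injective fun a => zetaFrom l ω a n := by
  induction n with
  | zero => exact fun a b hab => hab
  | succ n ih => exact fun a b hab => ih (h.nextOcc_injective _ hab)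

/-- The block read at an early time is still a suffix of the blocks read at later times. -/
lemma zetaFrom_block (hl : Monotone l) (ω : Path α) (a : ℤ) {i n : ℕ} (hin : i ≤ n) {j : ℕ}
    (hj : j < l (i + 1)) :
    ω (zetaFrom l ω a n - (j : ℤ)) = ω (zetaFrom l ω a i - (j : ℤ)) := by
  induction n, hin using Nat.le_induction with
  | base => rfl
  | succ n hin ih =>
    rw [← ih]
    exact nextOcc_block _ _ _ (hj.trans_le (hl (by omega)))

lemma exists_crossing {f : ℕ → ℤ} {N : ℤ} {k : ℕ} (h0 : f 0 < N) (hk : N ≤ f k) :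
    ∃ i < k, f i < N ∧ N ≤ f (i + 1) := by
  induction k with
  | zero => omega
  | succ k ih =>
    by_cases h : N ≤ f k
    · obtain ⟨i, hi, h'⟩ := ih h
      exact ⟨i, by omega, h'⟩
    · exact ⟨k, by omega, by omega, hk⟩

/-- At most `k` of the starting times below `N` are carried past `N` in `k` steps with a
prescribed block at the end. -/
lemma Recurrent.card_crossing_le (h : Recurrent ω) (hl : Monotone l) (k N : ℕ)
    (x : Fin (l k) → α) (S : Finset ℕ)
    (hS : ∀ s ∈ S, s < N ∧ (N : ℤ) ≤ zetaFrom l ω s k ∧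
      ∀ j : Fin (l k), ω (zetaFrom l ω s k - ((j : ℕ) : ℤ)) = x j) :
    S.card ≤ k := by
  have hcross : ∀ s ∈ S, ∃ i < k, zetaFrom l ω s i < N ∧ (N : ℤ) ≤ zetaFrom l ω s (i + 1) :=
    fun s hs => exists_crossing (by simpa [zetaFrom] using (hS s hs).1) (hS s hs).2.1
  choose! i hik hlt hle using hcross
  have key : ∀ s ∈ S, ∀ s' ∈ S, i s = i s' →
      ¬ zetaFrom l ω s (i s) < zetaFrom l ω s' (i s) := by
    intro s hs s' hs' hi hss
    have hN := hle s hs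
    have hN' := hlt s' hs'
    have := nextOcc_le (m := l (i s + 1)) (ω := ω) hss fun j hj => by
      have hjk : j < l k := hj.trans_le (hl (hik s hs))
      rw [← zetaFrom_block hl ω s (hik s hs).le hj,
        ← zetaFrom_block hl ω s' (hik s hs).le hj,
        (hS s hs).2.2 ⟨j, hjk⟩, (hS s' hs').2.2 ⟨j, hjk⟩]
    rw [← hi] at hN'
    simp only [zetaFrom] at hN
    omega
  calc S.card ≤ (Finset.range k).card := by
        refine Finset.card_le_card_of_injOn i (fun s hs => by simpa using hik s hs) ?_
        intro s hs s' hs' hi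
        have h1 := key s hs s' hs' hi
        have h2 := key s' hs' s hs hi.symm
        rw [← hi] at h2
        have : zetaFrom l ω s (i s) = zetaFrom l ω s' (i s) := by omega
        exact_mod_cast h.zetaFrom_injective l _ this
    _ = k := Finset.card_range k

lemma zeta_eq_zetaFrom (l : ℕ → ℕ) (ω : Path α) (n : ℕ) : zeta l ω n = zetaFrom l ω 0 n := by
  induction n with
  | zero => rfl
  | succ n ih => simp only [zeta, zetaFrom, nextOcc, ih]

lemma shift_iterate_apply (ω : Path α) (n : ℕ) (i : ℤ) : shift^[n] ω i = ω (i + n) := by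
  induction n generalizing ω with
  | zero => simp
  | succ n ih =>
    rw [Function.iterate_succ_apply, ih]
    simp only [shift]
    push_cast
    ring_nf

lemma zetaFrom_eq_add_zeta (l : ℕ → ℕ) (ω : Path α) (s n : ℕ) :
    zetaFrom l ω s n = s + zeta l (shift^[s] ω) n := by
  induction n with
  | zero => simp [zetaFrom, zeta]
  | succ n ih =>
    simp only [zetaFrom, zeta, nextOcc, ih, shift_iterate_apply, add_assoc]
    congr! 11 <;> ring

lemma tildePast_eq (hl : Monotone l) (ω : Path α) {k : ℕ} (hk : 1 ≤ k) {j : ℕ} (hj : j < l k) :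
    tildePast l ω j = ω (zeta l ω k - (j : ℤ)) := by
  have hmem : k ∈ {i : ℕ | 1 ≤ i ∧ j < l (i + 1)} := ⟨hk, hj.trans_le (hl (by omega))⟩
  have hJ : Jfun l j ≤ k := Nat.sInf_le hmem
  have hJ' : j < l (Jfun l j + 1) := (Nat.sInf_mem ⟨k, hmem⟩).2
  simp only [tildePast, zeta_eq_zetaFrom]
  exact (zetaFrom_block hl ω 0 hJ hJ').symm

end Combinatorics

section Measure

variable {α : Type*} [Countable α] [MeasurableSpace α] [MeasurableSingletonClass α]

lemma measurable_apply_eq_apply (a b : ℤ) : Measurable fun ω : Path α => ω a = ω b := by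
  have h : Measurable fun p : α × α => p.1 = p.2 := measurable_of_countable _
  have hab : Measurable fun ω : Path α => (ω a, ω b) :=
    (measurable_pi_apply a).prodMk (measurable_pi_apply b)
  exact h.comp hab

lemma measurable_sInf_nat {Ω : Type*} [MeasurableSpace Ω] {p : ℕ → Ω → Prop}
    (hp : ∀ t, Measurable (p t)) : Measurable fun ω => sInf {t : ℕ | p t ω} := by
  refine measurable_of_Iic fun n => ?_
  have heq : (fun ω => sInf {t : ℕ | p t ω}) ⁻¹' Iic n =
      {ω | (∃ t, t ≤ n ∧ p t ω) ∨ ∀ t, ¬ p t ω} := by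
    ext ω
    simp only [mem_preimage, mem_Iic, mem_ofPred_eq]
    constructor
    · intro h
      by_cases hex : ∃ t, p t ω
      · exact Or.inl ⟨_, h, Nat.sInf_mem (s := {t : ℕ | p t ω}) hex⟩
      · exact Or.inr (not_exists.1 hex)
    · rintro (⟨t, htn, ht⟩ | h)
      · exact (Nat.sInf_le (s := {t : ℕ | p t ω}) ht).trans htn
      · simp [h]
  rw [heq]
  exact measurableSet_setOfPred.2 ((Measurable.exists fun t => measurable_const.and (hp t)).or
    (Measurable.forall fun t => (hp t).not))

lemma measurableSet_cylinder {m : ℕ} (a : ℤ) (x : Fin m → α) :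
    MeasurableSet {ω : Path α | ∀ j : Fin m, ω (a - ((j : ℕ) : ℤ)) = x j} :=
  measurableSet_setOfPred.2 <| Measurable.forall fun j =>
    (measurable_of_countable fun y => y = x j).comp (measurable_pi_apply (a - ((j : ℕ) : ℤ)))

lemma measurable_nextOcc (m : ℕ) (a : ℤ) : Measurable fun ω : Path α => nextOcc m ω a :=
  (measurable_from_top (f := fun t : ℕ => a + (t : ℤ))).comp <| measurable_sInf_nat fun _ =>
    measurable_const.and <| Measurable.forall fun _ => measurable_const.imp <|
      measurable_apply_eq_apply _ _

lemma measurable_zeta (l : ℕ → ℕ) (n : ℕ) : Measurable fun ω : Path α => zeta l ω n := by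
  induction n with
  | zero => exact measurable_const
  | succ n ih =>
    have h : Measurable fun p : Path α × ℤ => nextOcc (l (n + 1)) p.1 p.2 :=
      measurable_from_prod_countable_left fun a => measurable_nextOcc _ a
    exact h.comp (measurable_id.prodMk ih)

omit [Countable α] [MeasurableSingletonClass α] in
lemma measurable_apply_int {f : Path α → ℤ} (hf : Measurable f) :
    Measurable fun ω : Path α => ω (f ω) := by
  have h : Measurable fun p : Path α × ℤ => p.1 p.2 :=
    measurable_from_prod_countable_left fun a => measurable_pi_apply a
  exact h.comp (measurable_id.prodMk hf)

lemma measurableSet_zeta_block (l : ℕ → ℕ) (k : ℕ) (n : ℤ) (x : Fin (l k) → α) :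
    MeasurableSet {ω : Path α | n ≤ zeta l ω k ∧
      ∀ j : Fin (l k), ω (zeta l ω k - ((j : ℕ) : ℤ)) = x j} := by
  have hle : Measurable fun ω : Path α => n ≤ zeta l ω k :=
    (measurable_from_top (f := fun z : ℤ => n ≤ z)).comp (measurable_zeta l k)
  have hblock : ∀ j : Fin (l k),
      Measurable fun ω : Path α => ω (zeta l ω k - ((j : ℕ) : ℤ)) = x j := fun j =>
    (measurable_of_countable fun y => y = x j).comp
      (measurable_apply_int ((measurable_zeta l k).sub_const _))
  exact measurableSet_setOfPred.2 (hle.and (Measurable.forall hblock))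

variable {μ : Measure (Path α)} [IsProbabilityMeasure μ]

lemma ae_recurrent (hT : MeasurePreserving (shift : Path α → Path α) μ μ) :
    ∀ᵐ ω ∂μ, Recurrent ω := by
  have h : ∀ᵐ ω ∂μ, ∀ (a : ℤ) (m : ℕ) (x : Fin m → α),
      (∀ j : Fin m, ω (a - ((j : ℕ) : ℤ)) = x j) →
      ∃ᶠ n in atTop, ∀ j : Fin m, (shift^[n] ω) (a - ((j : ℕ) : ℤ)) = x j := by
    simp only [ae_all_iff]
    exact fun a m x => hT.conservative.ae_mem_imp_frequently_image_mem
      (measurableSet_cylinder a x).nullMeasurableSet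
  filter_upwards [h] with ω hω a m
  obtain ⟨t, ht, hb⟩ :=
    frequently_atTop.1 (hω a m (fun j => ω (a - ((j : ℕ) : ℤ))) fun _ => rfl) 1
  refine ⟨t, ht, fun s hs => ?_⟩
  rw [← shift_iterate_apply ω]
  exact hb ⟨s, hs⟩

/-- A Kac-type inequality: `N · P(ζ_k ≥ N, X̃_{-l_k+1}^0 = x) ≤ k`. -/
lemma mul_measure_zeta_le (hT : MeasurePreserving (shift : Path α → Path α) μ μ)
    {l : ℕ → ℕ} (hl : Monotone l) (k N : ℕ) (x : Fin (l k) → α) :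
    N * μ {ω : Path α | (N : ℤ) ≤ zeta l ω k ∧
      ∀ j : Fin (l k), ω (zeta l ω k - ((j : ℕ) : ℤ)) = x j} ≤ k := by
  classical
  set A : ℤ → Set (Path α) := fun n => {ω | n ≤ zeta l ω k ∧
    ∀ j : Fin (l k), ω (zeta l ω k - ((j : ℕ) : ℤ)) = x j} with hA
  have hAm : ∀ n, MeasurableSet (A n) := fun n => measurableSet_zeta_block l k n x
  set D : ℕ → Set (Path α) := fun s => shift^[s] ⁻¹' A (N - s) with hD
  have hDm : ∀ s, MeasurableSet (D s) := fun s => (hT.iterate s).measurable (hAm _)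
  have hmem : ∀ s ω, ω ∈ D s → (N : ℤ) ≤ zetaFrom l ω s k ∧
      ∀ j : Fin (l k), ω (zetaFrom l ω s k - ((j : ℕ) : ℤ)) = x j := by
    rintro s ω ⟨h1, h2⟩
    rw [zetaFrom_eq_add_zeta]
    refine ⟨by omega, fun j => ?_⟩
    rw [← h2 j, shift_iterate_apply]
    congr 1
    ring
  calc (N : ℝ≥0∞) * μ (A N) = ∑ _s ∈ Finset.range N, μ (A N) := by simp
    _ ≤ ∑ s ∈ Finset.range N, μ (D s) := by
        refine Finset.sum_le_sum fun s _ => ?_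
        rw [hD, (hT.iterate s).measure_preimage (hAm _).nullMeasurableSet]
        exact measure_mono fun ω hω => ⟨le_trans (by simp) hω.1, hω.2⟩
    _ = ∫⁻ ω, ∑ s ∈ Finset.range N, (D s).indicator 1 ω ∂μ := by
        rw [lintegral_finsetSum _ fun s _ => measurable_one.indicator (hDm s)]
        simp [hDm]
    _ ≤ ∫⁻ _, k ∂μ := by
        refine lintegral_mono_ae ?_
        filter_upwards [ae_recurrent hT] with ω hω
        have hcard := hω.card_crossing_le hl k N x ((Finset.range N).filter fun s => ω ∈ D s)
          fun s hs => by
            rw [Finset.mem_filter, Finset.mem_range] at hs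
            exact ⟨hs.1, hmem s ω hs.2⟩
        simp only [indicator_apply, Pi.one_apply, Finset.sum_boole]
        exact_mod_cast hcard
    _ = k := by simp

/-- A union bound over the values of a discrete random variable whose joint measure with an event is
dominated, value by value, by the measures of disjoint sets. -/
lemma measure_le_of_fiber_le {Ω ι : Type*} [MeasurableSpace Ω] [Countable ι]
    {ν : Measure Ω} [IsProbabilityMeasure ν] {E : Set Ω} {f : Ω → ι} {C : ι → Set Ω} {c : ℝ≥0∞}
    (hC : ∀ i, MeasurableSet (C i)) (hdisj : Pairwise (Function.onFun Disjoint C))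
    (h : ∀ i, ν (E ∩ f ⁻¹' {i}) ≤ c * ν (C i)) : ν E ≤ c :=
  calc ν E ≤ ν (⋃ i, E ∩ f ⁻¹' {i}) := measure_mono fun ω hω => mem_iUnion.2 ⟨f ω, hω, rfl⟩
    _ ≤ ∑' i, ν (E ∩ f ⁻¹' {i}) := measure_iUnion_le _
    _ ≤ ∑' i, c * ν (C i) := ENNReal.tsum_le_tsum h
    _ = c * ν (⋃ i, C i) := by rw [ENNReal.tsum_mul_left, measure_iUnion hdisj hC]
    _ ≤ c := mul_le_of_le_one_right' prob_le_one

end Measure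

/-- Step 4. For every `k ≥ 1`,
`P(ζ_k ≥ 2^{l_k(H+ε₁)}, X̃_{-l_k+1}^0 ∈ B_k) ≤ (k+1) 2^{-l_k(ε₁-ε₂)}`, where
`B_k` is the set of strings of length `l_k` of probability `> 2^{-l_k(H+ε₂)}`. -/
theorem statement12
    {𝒳 : Type*} [Countable 𝒳] [MeasurableSpace 𝒳] [MeasurableSingletonClass 𝒳]
    (μ : Measure (Path 𝒳)) [IsProbabilityMeasure μ]
    (hErg : Ergodic (shift : Path 𝒳 → Path 𝒳) μ)
    (H : ℝ) (hH : HasEntropyRate μ H)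
    (l : ℕ → ℕ) (hl1 : l 1 = 1) (hlmono : Monotone l)
    (hlle : ∀ k, 1 ≤ k → l k ≤ k) (hltop : Tendsto l atTop atTop)
    (ε₁ ε₂ : ℝ) (hε₂ : 0 < ε₂) (hε : ε₂ < ε₁) (k : ℕ) (hk : 1 ≤ k) :
    μ {ω | (2 : ℝ) ^ ((l k : ℝ) * (H + ε₁)) ≤ (zeta l ω k : ℝ) ∧
        (2 : ℝ) ^ (-(l k : ℝ) * (H + ε₂)) < pstr μ (l k) (tildePast l ω)} ≤
      ENNReal.ofReal (((k : ℝ) + 1) * (2 : ℝ) ^ (-(l k : ℝ) * (ε₁ - ε₂))) := by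
  set E := {ω : Path 𝒳 | (2 : ℝ) ^ ((l k : ℝ) * (H + ε₁)) ≤ (zeta l ω k : ℝ) ∧
    (2 : ℝ) ^ (-(l k : ℝ) * (H + ε₂)) < pstr μ (l k) (tildePast l ω)} with hE
  set C : (Fin (l k) → 𝒳) → Set (Path 𝒳) := fun x =>
    {ω | ∀ j : Fin (l k), ω (0 - ((j : ℕ) : ℤ)) = x j} with hC
  refine measure_le_of_fiber_le (C := C)
    (f := fun ω (j : Fin (l k)) => ω (zeta l ω k - ((j : ℕ) : ℤ)))
    (fun x => measurableSet_cylinder 0 x) ?_ fun x => ?_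
  · intro x y hxy
    refine Set.disjoint_left.2 fun ω hx hy => hxy (funext fun j => ?_)
    rw [← hx j, ← hy j]
  set F := (fun (ω : Path 𝒳) (j : Fin (l k)) => ω (zeta l ω k - ((j : ℕ) : ℤ))) ⁻¹' {x} with hF
  have hpstr : ∀ ω ∈ F, pstr μ (l k) (tildePast l ω) = μ.real (C x) := by
    intro ω hω
    have hx : ∀ j : Fin (l k), ω (zeta l ω k - ((j : ℕ) : ℤ)) = x j := congrFun hω
    rw [pstr, measureReal_def]
    congr 2
    ext η
    simp only [hC, mem_ofPred_eq, Fin.forall_iff, zero_sub]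
    refine forall₂_congr fun j hj => ?_
    rw [tildePast_eq hlmono ω hk hj, ← hx ⟨j, hj⟩]
  rcases le_or_gt (μ.real (C x)) ((2 : ℝ) ^ (-(l k : ℝ) * (H + ε₂))) with hp | hp
  · have hempty : E ∩ F = ∅ := by
      refine eq_empty_of_forall_notMem fun ω hω => ?_
      have := hω.1.2
      rw [hpstr ω hω.2] at this
      exact absurd this hp.not_gt
    simp [hempty]
  set r : ℝ := (2 : ℝ) ^ ((l k : ℝ) * (H + ε₁)) with hr
  set δ : ℝ := (2 : ℝ) ^ (-(l k : ℝ) * (H + ε₂)) with hδ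
  have hr0 : 0 < r := by positivity
  have hrδ : (2 : ℝ) ^ (-(l k : ℝ) * (ε₁ - ε₂)) * δ = r⁻¹ := by
    rw [hδ, hr, ← Real.rpow_add two_pos, ← Real.rpow_neg two_pos.le]
    congr 1
    ring
  have hEF : μ.real (E ∩ F) ≤ k * r⁻¹ := by
    have hkac := mul_measure_zeta_le hErg.toMeasurePreserving hlmono k ⌈r⌉₊ x
    have hsub : μ (E ∩ F) ≤ μ {ω : Path 𝒳 | ((⌈r⌉₊ : ℕ) : ℤ) ≤ zeta l ω k ∧
        ∀ j : Fin (l k), ω (zeta l ω k - ((j : ℕ) : ℤ)) = x j} := by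
      refine measure_mono fun ω hω => ⟨?_, congrFun hω.2⟩
      rw [Int.natCast_ceil_eq_ceil hr0.le]
      exact Int.ceil_le.2 hω.1.1
    have hkac' : (⌈r⌉₊ : ℝ) * μ.real (E ∩ F) ≤ k := by
      have := ENNReal.toReal_mono (ENNReal.natCast_ne_top k) ((mul_le_mul_right hsub _).trans hkac)
      simpa [measureReal_def] using this
    rw [← div_eq_mul_inv, le_div_iff₀ hr0, mul_comm]
    exact (mul_le_mul_of_nonneg_right (Nat.le_ceil r) measureReal_nonneg).trans hkac'
  rw [← ofReal_measureReal, ← ofReal_measureReal, ← ENNReal.ofReal_mul (by positivity)]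
  refine ENNReal.ofReal_le_ofReal (hEF.trans ?_)
  calc (k : ℝ) * r⁻¹ ≤ (k + 1) * r⁻¹ := by gcongr; linarith
    _ = (k + 1) * (2 : ℝ) ^ (-(l k : ℝ) * (ε₁ - ε₂)) * δ := by rw [mul_assoc, hrδ]
    _ ≤ (k + 1) * (2 : ℝ) ^ (-(l k : ℝ) * (ε₁ - ε₂)) * μ.real (C x) := by gcongr

end MWPrediction
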